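/- Averaging property: let α ∈ (0,1), π ∈ Π, and let 𝒬^π = (Q₁^π, Q₂^π) be the unique fixed point of T^π_α. Then for all (x,a) ∈ X×A, α Q₁^π(x,a) + (1−α) Q₂^π(x,a) = Q^π(x,a), where Q^π is the classical action-value function of π. -/

import Mathlib

open MeasureTheory ProbabilityTheory Finset Set

noncomputable section

/-- Quantile (generalized inverse distribution) function of a measure on `ℝ`. -/
def quantileFn (ν : Measure ℝ) (τ : ℝ) : ℝ :=
  sInf {z : ℝ | τ ≤ cdf ν z}

/-- Left average value-at-risk at level `α`. -/
def avarLeft (α : ℝ) (ν : Measure ℝ) : ℝ :=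
  (1 / α) * ∫ τ in (0:ℝ)..α, quantileFn ν τ

/-- Right average value-at-risk at level `1 - α`. -/
def avarRight (α : ℝ) (ν : Measure ℝ) : ℝ :=
  (1 / (1 - α)) * ∫ τ in α..(1:ℝ), quantileFn ν τ

/-- A measure on `ℝ` with bounded support. -/
def HasBoundedSupport (ν : Measure ℝ) : Prop :=
  ∃ a b : ℝ, ν (Set.Icc a b)ᶜ = 0

/-- Finite Markov decision process with fixed state and action spaces. -/
structure MDP (X A : Type) [Fintype X] [Fintype A] where
  P : X → A → X → ℝ
  r : X → A → X → ℝ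
  γ : ℝ
  P_nonneg : ∀ x a x', 0 ≤ P x a x'
  P_sum_one : ∀ x a, ∑ x', P x a x' = 1
  γ_nonneg : 0 ≤ γ
  γ_lt_one : γ < 1

variable {X A : Type} [Fintype X] [Fintype A]

/-- A stationary Markovian policy. -/
def IsPolicy (π : X → A → ℝ) : Prop :=
  (∀ x a, 0 ≤ π x a) ∧ ∀ x, ∑ a, π x a = 1

/-- The discrete measure `(T^π D_{α,Q})^{(x,a)}`. -/
def diatomicMeasure (M : MDP X A) (α : ℝ) (π : X → A → ℝ)
    (Q : X → A → ℝ × ℝ) (x : X) (a : A) : Measure ℝ :=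
  ∑ x' : X, ∑ a' : A, ENNReal.ofReal (M.P x a x' * π x' a') •
    (ENNReal.ofReal α • Measure.dirac (M.r x a x' + M.γ * (Q x' a').1)
      + ENNReal.ofReal (1 - α) • Measure.dirac (M.r x a x' + M.γ * (Q x' a').2))

/-- The diatomic Bellman operator `T^π_α`. -/
def diatomicT (M : MDP X A) (α : ℝ) (π : X → A → ℝ)
    (Q : X → A → ℝ × ℝ) : X → A → ℝ × ℝ :=
  fun x a => (avarLeft α (diatomicMeasure M α π Q x a),
              avarRight α (diatomicMeasure M α π Q x a))

/-- The quantile function is the lower adjoint of the distribution function. -/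
theorem quantileFn_le_iff (ν : Measure ℝ) {τ : ℝ} (hτ : τ ∈ Set.Ioo (0 : ℝ) 1) (z : ℝ) :
    quantileFn ν τ ≤ z ↔ τ ≤ cdf ν z := by
  obtain ⟨w, hw⟩ := ((tendsto_cdf_atBot ν).eventually_lt_const hτ.1).exists
  obtain ⟨u, hu⟩ := ((tendsto_cdf_atTop ν).eventually_const_lt hτ.2).exists
  have hbdd : BddBelow {z : ℝ | τ ≤ cdf ν z} := by
    refine ⟨w, fun y (hy : τ ≤ cdf ν y) => ?_⟩
    by_contra! h
    linarith [monotone_cdf ν h.le]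
  refine ⟨fun h => ?_, fun h => csInf_le hbdd h⟩
  have hev : ∀ᶠ y in nhdsWithin z (Set.Ioi z), τ ≤ cdf ν y := by
    filter_upwards [self_mem_nhdsWithin] with y hy
    obtain ⟨t, ht, hty⟩ := exists_lt_of_csInf_lt ⟨u, hu.le⟩ (lt_of_le_of_lt h hy)
    exact le_trans ht (monotone_cdf ν hty.le)
  have hcont : Filter.Tendsto (cdf ν) (nhdsWithin z (Set.Ioi z)) (nhds (cdf ν z)) :=
    ((cdf ν).right_continuous z).mono Set.Ioi_subset_Ici_self
  exact ge_of_tendsto hcont hev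

theorem monotoneOn_quantileFn (ν : Measure ℝ) :
    MonotoneOn (quantileFn ν) (Set.Ioo (0 : ℝ) 1) := fun _ hs _ ht hst =>
  (quantileFn_le_iff ν hs _).2 (hst.trans ((quantileFn_le_iff ν ht _).1 le_rfl))

theorem aemeasurable_quantileFn (ν : Measure ℝ) :
    AEMeasurable (quantileFn ν) (volume.restrict (Set.Ioo (0 : ℝ) 1)) :=
  aemeasurable_restrict_of_monotoneOn measurableSet_Ioo (monotoneOn_quantileFn ν)

/-- The quantile transform: a probability measure is the law of its quantile function. -/
theorem map_quantileFn (ν : Measure ℝ) [IsProbabilityMeasure ν] :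
    (volume.restrict (Set.Ioo (0 : ℝ) 1)).map (quantileFn ν) = ν := by
  have hfin : IsProbabilityMeasure (volume.restrict (Set.Ioo (0 : ℝ) 1)) := ⟨by simp⟩
  refine Measure.ext_of_Iic _ _ fun z => ?_
  rw [Measure.map_apply_of_aemeasurable (aemeasurable_quantileFn ν) measurableSet_Iic,
    Measure.restrict_apply' measurableSet_Ioo, ← ofReal_cdf]
  have hset : quantileFn ν ⁻¹' Set.Iic z ∩ Set.Ioo (0 : ℝ) 1
      = Set.Iic (cdf ν z) ∩ Set.Ioo (0 : ℝ) 1 := by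
    ext τ
    exact and_congr_left fun hτ => quantileFn_le_iff ν hτ z
  rw [hset]
  have hle : (Set.Ioo 0 (cdf ν z) : Set ℝ) ⊆ Set.Iic (cdf ν z) ∩ Set.Ioo (0 : ℝ) 1 :=
    fun τ hτ => ⟨hτ.2.le, hτ.1, hτ.2.trans_le (cdf_le_one ν z)⟩
  have hge : Set.Iic (cdf ν z) ∩ Set.Ioo (0 : ℝ) 1 ⊆ Set.Ioc 0 (cdf ν z) :=
    fun τ hτ => ⟨hτ.2.1, hτ.1⟩
  refine le_antisymm ((measure_mono hge).trans ?_) (le_trans ?_ (measure_mono hle)) <;> simp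

theorem integral_quantileFn (ν : Measure ℝ) [IsProbabilityMeasure ν] :
    ∫ τ in (0 : ℝ)..1, quantileFn ν τ = ∫ y, y ∂ν := by
  rw [intervalIntegral.integral_of_le zero_le_one, integral_Ioc_eq_integral_Ioo]
  conv_rhs => rw [← map_quantileFn ν]
  exact (integral_map (aemeasurable_quantileFn ν) aestronglyMeasurable_id).symm

theorem intervalIntegrable_quantileFn (ν : Measure ℝ) [IsProbabilityMeasure ν]
    (hν : Integrable (fun y => y) ν) :
    IntervalIntegrable (quantileFn ν) volume 0 1 := by
  rw [intervalIntegrable_iff_integrableOn_Ioo_of_le zero_le_one]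
  rw [← map_quantileFn ν] at hν
  exact (integrable_map_measure aestronglyMeasurable_id (aemeasurable_quantileFn ν)).1 hν

/-- The left and right average values-at-risk average to the mean. -/
theorem avarLeft_add_avarRight (ν : Measure ℝ) [IsProbabilityMeasure ν]
    (hν : Integrable (fun y => y) ν) {α : ℝ} (hα : α ∈ Set.Ioo (0 : ℝ) 1) :
    α * avarLeft α ν + (1 - α) * avarRight α ν = ∫ y, y ∂ν := by
  have h0 : α ≠ 0 := hα.1.ne'
  have h1 : 1 - α ≠ 0 := (sub_pos.2 hα.2).ne'
  have hint := intervalIntegrable_quantileFn ν hν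
  have hmem : α ∈ Set.uIcc (0 : ℝ) 1 := by
    rw [Set.uIcc_of_le zero_le_one]
    exact Set.Ioo_subset_Icc_self hα
  have hadd := intervalIntegral.integral_add_adjacent_intervals
    (hint.mono_set (Set.uIcc_subset_uIcc_left hmem))
    (hint.mono_set (Set.uIcc_subset_uIcc_right hmem))
  rw [← integral_quantileFn, ← hadd, avarLeft, avarRight, ← mul_assoc, ← mul_assoc,
    mul_one_div_cancel h0, mul_one_div_cancel h1, one_mul, one_mul]

theorem MDP.sum_transition (M : MDP X A) {π : X → A → ℝ} (hπ : IsPolicy π) (x : X) (a : A) :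
    ∑ x', ∑ a', M.P x a x' * π x' a' = 1 := by
  simp_rw [← Finset.mul_sum, hπ.2, mul_one, M.P_sum_one]

theorem isProbabilityMeasure_diatomicMeasure (M : MDP X A) {α : ℝ} (hα : α ∈ Set.Ioo (0 : ℝ) 1)
    {π : X → A → ℝ} (hπ : IsPolicy π) (Q : X → A → ℝ × ℝ) (x : X) (a : A) :
    IsProbabilityMeasure (diatomicMeasure M α π Q x a) := by
  have hw : ∀ x' a', 0 ≤ M.P x a x' * π x' a' := fun x' a' =>
    mul_nonneg (M.P_nonneg x a x') (hπ.1 x' a')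
  constructor
  simp only [diatomicMeasure, Measure.finsetSum_apply, Measure.smul_apply, Measure.add_apply,
    measure_univ, smul_eq_mul, mul_one]
  simp_rw [← ENNReal.ofReal_add hα.1.le (sub_pos.2 hα.2).le, add_sub_cancel,
    ENNReal.ofReal_one, mul_one]
  simp_rw [← ENNReal.ofReal_sum_of_nonneg fun a' _ => hw _ a']
  rw [← ENNReal.ofReal_sum_of_nonneg fun x' _ => Finset.sum_nonneg fun a' _ => hw x' a',
    M.sum_transition hπ, ENNReal.ofReal_one]

theorem integrable_diatom (f : ℝ → ℝ) (p q y z : ℝ) :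
    Integrable f (ENNReal.ofReal p • Measure.dirac y + ENNReal.ofReal q • Measure.dirac z) :=
  ((integrable_dirac (by simp)).smul_measure ENNReal.ofReal_ne_top).add_measure
    ((integrable_dirac (by simp)).smul_measure ENNReal.ofReal_ne_top)

theorem integrable_diatomicMeasure (M : MDP X A) (α : ℝ) (π : X → A → ℝ)
    (Q : X → A → ℝ × ℝ) (x : X) (a : A) (f : ℝ → ℝ) :
    Integrable f (diatomicMeasure M α π Q x a) :=
  integrable_finsetSum_measure.2 fun _ _ => integrable_finsetSum_measure.2 fun _ _ =>
    (integrable_diatom f _ _ _ _).smul_measure ENNReal.ofReal_ne_top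

theorem integral_diatomicMeasure (M : MDP X A) {α : ℝ} (hα : α ∈ Set.Ioo (0 : ℝ) 1)
    {π : X → A → ℝ} (hπ : IsPolicy π) (Q : X → A → ℝ × ℝ) (x : X) (a : A) :
    ∫ y, y ∂(diatomicMeasure M α π Q x a) = ∑ x', ∑ a', M.P x a x' * π x' a' *
      (M.r x a x' + M.γ * (α * (Q x' a').1 + (1 - α) * (Q x' a').2)) := by
  have hint : ∀ x' a', Integrable (fun y : ℝ => y)
      (ENNReal.ofReal (M.P x a x' * π x' a') •
        (ENNReal.ofReal α • Measure.dirac (M.r x a x' + M.γ * (Q x' a').1)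
          + ENNReal.ofReal (1 - α) • Measure.dirac (M.r x a x' + M.γ * (Q x' a').2))) :=
    fun x' a' => (integrable_diatom _ _ _ _ _).smul_measure ENNReal.ofReal_ne_top
  rw [diatomicMeasure, integral_finsetSum_measure fun x' _ =>
    integrable_finsetSum_measure.2 fun a' _ => hint x' a']
  refine Finset.sum_congr rfl fun x' _ => ?_
  rw [integral_finsetSum_measure fun a' _ => hint x' a']
  refine Finset.sum_congr rfl fun a' _ => ?_
  rw [integral_smul_measure, integral_add_measure
    ((integrable_dirac (by simp)).smul_measure ENNReal.ofReal_ne_top)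
    ((integrable_dirac (by simp)).smul_measure ENNReal.ofReal_ne_top),
    integral_smul_measure, integral_smul_measure, integral_dirac, integral_dirac,
    ENNReal.toReal_ofReal (mul_nonneg (M.P_nonneg x a x') (hπ.1 x' a')),
    ENNReal.toReal_ofReal hα.1.le, ENNReal.toReal_ofReal (sub_pos.2 hα.2).le]
  simp only [smul_eq_mul]
  ring

/-- The classical Bellman equation has at most one solution. -/
theorem MDP.bellman_unique (M : MDP X A) {π : X → A → ℝ} (hπ : IsPolicy π) {V W : X → A → ℝ}
    (hV : ∀ x a, V x a = ∑ x', ∑ a', M.P x a x' * π x' a' * (M.r x a x' + M.γ * V x' a'))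
    (hW : ∀ x a, W x a = ∑ x', ∑ a', M.P x a x' * π x' a' * (M.r x a x' + M.γ * W x' a'))
    (x : X) (a : A) : V x a = W x a := by
  have : Nonempty (X × A) := ⟨(x, a)⟩
  obtain ⟨p, hp⟩ := Finite.exists_max fun q : X × A => |V q.1 q.2 - W q.1 q.2|
  have hw : ∀ x' a', 0 ≤ M.P p.1 p.2 x' * π x' a' := fun x' a' =>
    mul_nonneg (M.P_nonneg p.1 p.2 x') (hπ.1 x' a')
  have hcontr : |V p.1 p.2 - W p.1 p.2| ≤ M.γ * |V p.1 p.2 - W p.1 p.2| := by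
    calc |V p.1 p.2 - W p.1 p.2|
        = |∑ x', ∑ a', M.P p.1 p.2 x' * π x' a' * (M.γ * (V x' a' - W x' a'))| := by
          rw [hV p.1 p.2, hW p.1 p.2, ← Finset.sum_sub_distrib]
          simp_rw [← Finset.sum_sub_distrib]
          refine congrArg _ (Finset.sum_congr rfl fun x' _ => Finset.sum_congr rfl fun a' _ => ?_)
          ring
      _ ≤ ∑ x', ∑ a', M.P p.1 p.2 x' * π x' a' * (M.γ * |V p.1 p.2 - W p.1 p.2|) := by
          refine (Finset.abs_sum_le_sum_abs _ _).trans (Finset.sum_le_sum fun x' _ => ?_)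
          refine (Finset.abs_sum_le_sum_abs _ _).trans (Finset.sum_le_sum fun a' _ => ?_)
          rw [abs_mul, abs_of_nonneg (hw x' a'), abs_mul, abs_of_nonneg M.γ_nonneg]
          exact mul_le_mul_of_nonneg_left
            (mul_le_mul_of_nonneg_left (hp (x', a')) M.γ_nonneg) (hw x' a')
      _ = M.γ * |V p.1 p.2 - W p.1 p.2| := by
          simp_rw [← Finset.sum_mul]
          rw [M.sum_transition hπ, one_mul]
  have hzero : |V p.1 p.2 - W p.1 p.2| ≤ 0 := by
    nlinarith [M.γ_lt_one]
  exact sub_eq_zero.1 (abs_nonpos_iff.1 ((hp (x, a)).trans hzero))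

theorem stmt8 (M : MDP X A) (α : ℝ) (hα : α ∈ Set.Ioo (0:ℝ) 1)
    (π : X → A → ℝ) (hπ : IsPolicy π)
    (Qpi : X → A → ℝ × ℝ) (hfix : diatomicT M α π Qpi = Qpi)
    (Qcl : X → A → ℝ)
    (hQcl : ∀ x a, Qcl x a =
      ∑ x', ∑ a', M.P x a x' * π x' a' * (M.r x a x' + M.γ * Qcl x' a')) :
    ∀ x a, α * (Qpi x a).1 + (1 - α) * (Qpi x a).2 = Qcl x a := by
  refine M.bellman_unique hπ (V := fun x a => α * (Qpi x a).1 + (1 - α) * (Qpi x a).2)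
    (fun x a => ?_) hQcl
  have := isProbabilityMeasure_diatomicMeasure M hα hπ Qpi x a
  rw [← integral_diatomicMeasure M hα hπ, ← avarLeft_add_avarRight _
    (integrable_diatomicMeasure M α π Qpi x a _) hα]
  have h := congrFun (congrFun hfix x) a
  exact congrArg (fun q : ℝ × ℝ => α * q.1 + (1 - α) * q.2) h.symm

end
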